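/- arXiv:1409.8141 — 7 statements merged into one kernel-verified Lean document; each statement's English description precedes it below -/
import Mathlib

section
/- Let G be a triangle-free simple graph on n vertices that contains t pairwise vertex-disjoint 5-cycles (so 5t ≤ n). Then the number of edges of G is at most 5t + 10·(t(t−1)/2) + (n−5t)²/4 + 2t(n−5t), which equals (5/4)t² − tn/2 + n²/4. -/
/-- `c` describes a 5-cycle in `G`: five distinct vertices that are cyclically adjacent. -/
def SimpleGraph.IsC5 {V : Type*} (G : SimpleGraph V) (c : Fin 5 → V) : Prop :=
  Function.Injective c ∧ ∀ i : Fin 5, G.Adj (c i) (c (i + 1))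

open Finset in
/-- Mantel's theorem inside a vertex set `U`, counting ordered adjacent pairs. -/
theorem SimpleGraph.CliqueFree.two_mul_sum_adj_le_sq {V : Type*} {G : SimpleGraph V}
    [DecidableRel G.Adj] (hG : G.CliqueFree 3) (U : Finset V) :
    2 * ∑ u ∈ U, ∑ w ∈ U, (if G.Adj u w then 1 else 0) ≤ #U ^ 2 := by
  classical
  have hsum : ∑ u ∈ U, ∑ w ∈ U, (if G.Adj u w then 1 else 0) =
      2 * #(G.induce (U : Set V)).edgeFinset := by
    rw [← SimpleGraph.sum_degrees_eq_twice_card_edges, ← Finset.sum_coe_sort U]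
    refine Finset.sum_congr rfl fun u _ => ?_
    rw [← Finset.sum_coe_sort U, ← SimpleGraph.card_neighborFinset_eq_degree,
      SimpleGraph.neighborFinset_eq_filter, Finset.card_filter]
    rfl
  have hmantel :=
    (hG.comap (SimpleGraph.Embedding.induce (G := G) (U : Set V)).isContained).card_edgeFinset_le
  have hcard : Fintype.card (U : Set V) = #U := by simp
  rw [hcard] at hmantel
  have hchoose : (#U % 2).choose 2 = 0 := Nat.choose_eq_zero_of_lt (Nat.mod_lt _ two_pos)
  have hdiv := Nat.div_mul_le_self ((#U ^ 2 - (#U % 2) ^ 2) * (2 - 1)) (2 * 2)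
  rw [hsum]
  omega

/-- In a triangle-free graph every vertex has at most two neighbours on a 5-cycle. -/
theorem SimpleGraph.CliqueFree.sum_adj_C5_le_two {V : Type*} {G : SimpleGraph V}
    [DecidableRel G.Adj] (hG : G.CliqueFree 3) {c : Fin 5 → V} (hc : G.IsC5 c) (v : V) :
    ∑ i, (if G.Adj v (c i) then 1 else 0) ≤ 2 := by
  classical
  have hpair (i : Fin 5) :
      (if G.Adj v (c i) then 1 else 0) + (if G.Adj v (c (i + 1)) then 1 else 0) ≤ 1 := by
    by_cases h₁ : G.Adj v (c i) <;> by_cases h₂ : G.Adj v (c (i + 1)) <;> simp [h₁, h₂]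
    exact hG _ (SimpleGraph.is3Clique_triple_iff.2 ⟨h₁, h₂, hc.2 i⟩)
  have hshift : ∑ i, (if G.Adj v (c (i + 1)) then 1 else 0) =
      ∑ i, (if G.Adj v (c i) then 1 else 0) :=
    Equiv.sum_comp (Equiv.addRight (1 : Fin 5)) fun i => if G.Adj v (c i) then 1 else 0
  have hle := Finset.sum_le_sum fun i (_ : i ∈ Finset.univ) => hpair i
  simp only [Finset.sum_add_distrib, Finset.sum_const, Finset.card_univ,
    Fintype.card_fin, smul_eq_mul] at hle
  omega

/-- A triangle-free graph on `n` vertices containing `t` pairwise vertex-disjoint 5-cycles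
(so `5t ≤ n`) has at most `5t + 10·(t(t−1)/2) + (n−5t)²/4 + 2t(n−5t)` edges, and this bound
equals `(5/4)t² − tn/2 + n²/4`. -/
theorem edge_bound_of_disjoint_C5s {V : Type*} [Fintype V] [DecidableEq V]
    {G : SimpleGraph V} [DecidableRel G.Adj] (hG : G.CliqueFree 3)
    {n t : ℕ} (hn : Fintype.card V = n)
    (c : Fin t → Fin 5 → V) (hc : ∀ k, G.IsC5 (c k))
    (hdisj : ∀ k l : Fin t, k ≠ l → ∀ i j : Fin 5, c k i ≠ c l j)
    (h5t : 5 * t ≤ n) :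
    (G.edgeFinset.card : ℝ) ≤
        5 * t + 10 * (t * (t - 1) / 2) + (n - 5 * t) ^ 2 / 4 + 2 * t * (n - 5 * t) ∧
      (5 * (t : ℝ) + 10 * (t * (t - 1) / 2) + ((n : ℝ) - 5 * t) ^ 2 / 4
          + 2 * t * ((n : ℝ) - 5 * t)
        = (5 / 4) * t ^ 2 - t * n / 2 + n ^ 2 / 4) := by
  classical
  refine ⟨?_, by ring⟩
  let a (v w : V) : ℕ := if G.Adj v w then 1 else 0
  have ha (v w : V) : a v w = a w v := by simp only [a, G.adj_comm]
  have hinj : Function.Injective fun p : Fin t × Fin 5 => c p.1 p.2 := by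
    rintro ⟨k, i⟩ ⟨l, j⟩ h
    obtain rfl : k = l := by_contra fun hkl => hdisj k l hkl i j h
    exact congrArg (Prod.mk k) ((hc k).1 h)
  let S : Finset V := Finset.univ.map ⟨_, hinj⟩
  have hS : S.card = 5 * t := by simp [S, mul_comm]
  have hU : 5 * t + Sᶜ.card = n := by rw [← hS, Finset.card_add_card_compl, hn]
  have hdegS (v : V) : ∑ w ∈ S, a v w ≤ 2 * t := by
    rw [Finset.sum_map, Fintype.sum_prod_type]
    refine (Finset.sum_le_card_nsmul _ _ 2 fun k _ => hG.sum_adj_C5_le_two (hc k) v).trans ?_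
    simp [mul_comm]
  have hdeg (v : V) : ∑ w ∈ S, a v w + ∑ w ∈ Sᶜ, a v w = G.degree v := by
    rw [Finset.sum_add_sum_compl, ← SimpleGraph.card_neighborFinset_eq_degree,
      SimpleGraph.neighborFinset_eq_filter, Finset.card_filter]
  have hedges := G.sum_degrees_eq_twice_card_edges
  simp only [← hdeg, Finset.sum_add_distrib] at hedges
  rw [← Finset.sum_add_sum_compl S fun v => ∑ w ∈ Sᶜ, a v w] at hedges
  have hcross : ∑ v ∈ S, ∑ w ∈ Sᶜ, a v w = ∑ w ∈ Sᶜ, ∑ v ∈ S, a w v := by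
    rw [Finset.sum_comm]
    simp only [ha]
  have hall := Finset.sum_le_card_nsmul Finset.univ _ (2 * t) fun v _ => hdegS v
  have hout := Finset.sum_le_card_nsmul Sᶜ _ (2 * t) fun v _ => hdegS v
  have hmantel : 2 * ∑ u ∈ Sᶜ, ∑ w ∈ Sᶜ, a u w ≤ Sᶜ.card ^ 2 := hG.two_mul_sum_adj_le_sq Sᶜ
  rw [Finset.card_univ, hn, smul_eq_mul] at hall
  rw [smul_eq_mul, ← hcross] at hout
  have hnat : 4 * G.edgeFinset.card ≤
      2 * (n * (2 * t)) + 2 * (Sᶜ.card * (2 * t)) + Sᶜ.card ^ 2 := by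
    omega
  have hreal : (4 * G.edgeFinset.card : ℝ) ≤
      2 * (n * (2 * t)) + 2 * (Sᶜ.card * (2 * t)) + (Sᶜ.card : ℝ) ^ 2 := by
    exact_mod_cast hnat
  have hUreal : (n : ℝ) = 5 * t + Sᶜ.card := by exact_mod_cast hU.symm
  rw [hUreal] at hreal ⊢
  linarith
end

section
/- Let G be a triangle-free simple graph on n vertices (n ≥ 2) that contains at least ⌊(n−2)/11⌋ pairwise vertex-disjoint 5-cycles. Then the number of edges of G is at most (26/121)·n² + n. -/
namespace SimpleGraph

open Finset

variable {V : Type*} {G : SimpleGraph V} [DecidableRel G.Adj]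

/-- In a triangle-free graph every vertex has at most two neighbours on a given 5-cycle. -/
theorem IsC5.card_filter_adj_le_two (hG : G.CliqueFree 3) {c : Fin 5 → V} (hc : G.IsC5 c)
    (v : V) : #{i | G.Adj v (c i)} ≤ 2 := by
  have no_consecutive (i : Fin 5) (hi : G.Adj v (c i)) : ¬ G.Adj v (c (i + 1)) := fun hi' ↦ by
    classical
    exact hG {v, c i, c (i + 1)} (is3Clique_triple_iff.2 ⟨hi, hi', hc.2 i⟩)
  have independent_in_cycle : ∀ s : Finset (Fin 5), (∀ i ∈ s, i + 1 ∉ s) → #s ≤ 2 := by decide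
  refine independent_in_cycle _ fun i hi ↦ ?_
  simpa using no_consecutive i (by simpa using hi)

/-- Mantel's theorem for the subgraph induced on `T`, counting ordered adjacent pairs. -/
theorem CliqueFree.two_mul_sum_card_filter_adj_le [Fintype V] [DecidableEq V]
    (hG : G.CliqueFree 3) (T : Finset V) :
    2 * ∑ v ∈ T, #{w ∈ T | G.Adj v w} ≤ #T ^ 2 := by
  have free : (G.induce (T : Set V)).CliqueFree (2 + 1) := hG.comap (Embedding.induce _).isContained
  have mantel := free.card_edgeFinset_le
  have degree_eq (v : (T : Set V)) :
      (G.induce (T : Set V)).degree v = #{w ∈ T | G.Adj v w} := by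
    rw [← card_neighborFinset_eq_degree,
      ← card_map (Function.Embedding.subtype (· ∈ (T : Set V)))]
    congr 1
    ext w
    simp [and_comm]
  have sum_eq := (G.induce (T : Set V)).sum_degrees_eq_twice_card_edges
  simp only [degree_eq] at sum_eq
  have sum_subtype : ∑ v : (T : Set V), #{w ∈ T | G.Adj v w} = ∑ v ∈ T, #{w ∈ T | G.Adj v w} :=
    Finset.sum_coe_sort T fun v ↦ #{w ∈ T | G.Adj v w}
  rw [sum_subtype] at sum_eq
  have card_T : Fintype.card (T : Set V) = #T := by simp
  simp only [card_T] at mantel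
  rw [sum_eq]
  rcases Nat.mod_two_eq_zero_or_one #T with h | h <;> simp [h] at mantel
  · omega
  · have : 1 ≤ #T ^ 2 := Nat.one_le_pow _ _ (by omega)
    omega

/-- If every vertex has at most `d` neighbours in `S`, a triangle-free graph has few edges. -/
theorem CliqueFree.four_mul_card_edgeFinset_le [Fintype V] [DecidableEq V]
    (hG : G.CliqueFree 3) (S : Finset V) (d : ℕ) (hd : ∀ v, #{w ∈ S | G.Adj v w} ≤ d) :
    4 * #G.edgeFinset ≤ 2 * (d * Fintype.card V) + 2 * (d * #Sᶜ) + #Sᶜ ^ 2 := by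
  have degree_eq (v : V) :
      G.degree v = #{w ∈ S | G.Adj v w} + #{w ∈ Sᶜ | G.Adj v w} := by
    rw [← card_neighborFinset_eq_degree, ← card_union_of_disjoint
      (disjoint_filter_filter disjoint_compl_right), ← filter_union, union_compl]
    congr 1
    ext w
    simp
  have sum_into_S : ∑ v, #{w ∈ S | G.Adj v w} ≤ d * Fintype.card V := by
    simpa [mul_comm] using sum_le_card_nsmul univ _ d fun v _ ↦ hd v
  have sum_across : ∑ v ∈ S, #{w ∈ Sᶜ | G.Adj v w} ≤ d * #Sᶜ := by
    have swap : ∑ v ∈ S, #{w ∈ Sᶜ | G.Adj v w} = ∑ w ∈ Sᶜ, #{v ∈ S | G.Adj v w} :=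
      sum_card_bipartiteAbove_eq_sum_card_bipartiteBelow G.Adj
    rw [swap]
    simpa [mul_comm, G.adj_comm] using sum_le_card_nsmul Sᶜ _ d fun v _ ↦ hd v
  have split := sum_add_sum_compl S fun v ↦ #{w ∈ Sᶜ | G.Adj v w}
  have handshake := G.sum_degrees_eq_twice_card_edges
  simp only [degree_eq, sum_add_distrib] at handshake
  have mantel := hG.two_mul_sum_card_filter_adj_le Sᶜ
  omega

end SimpleGraph

/-- If `G` is a triangle-free graph on `n ≥ 2` vertices containing at least `⌊(n−2)/11⌋`
pairwise vertex-disjoint 5-cycles, then `G` has at most `(26/121)·n² + n` edges. -/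
theorem edge_bound_of_game_C5s {V : Type*} [Fintype V] [DecidableEq V]
    {G : SimpleGraph V} [DecidableRel G.Adj] (hG : G.CliqueFree 3)
    {n : ℕ} (hn2 : 2 ≤ n) (hn : Fintype.card V = n)
    (c : Fin ((n - 2) / 11) → Fin 5 → V) (hc : ∀ m, G.IsC5 (c m))
    (hdisj : ∀ m l : Fin ((n - 2) / 11), m ≠ l → ∀ i j : Fin 5, c m i ≠ c l j) :
    (G.edgeFinset.card : ℝ) ≤ (26 / 121) * n ^ 2 + n := by
  obtain ⟨k, hk⟩ : ∃ k, k = (n - 2) / 11 := ⟨_, rfl⟩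
  revert c
  rw [← hk]
  intro c hc hdisj
  have inj : Function.Injective fun p : Fin k × Fin 5 ↦ c p.1 p.2 := by
    rintro ⟨m, i⟩ ⟨l, j⟩ h
    obtain rfl : m = l := by_contra fun hml ↦ hdisj m l hml i j h
    exact congrArg _ ((hc m).1 h)
  let S : Finset V := Finset.univ.map ⟨_, inj⟩
  have card_S : S.card = k * 5 := by simp [S]
  have few_neighbors (v : V) : (S.filter (G.Adj v)).card ≤ 2 * k := by
    have : (S.filter (G.Adj v)).card =
        ∑ m, (Finset.univ.filter fun i ↦ G.Adj v (c m i)).card := by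
      rw [Finset.filter_map, Finset.card_map]
      simp only [Finset.card_filter, Fintype.sum_prod_type, Function.comp_apply,
        Function.Embedding.coeFn_mk]
    rw [this]
    simpa [mul_comm] using Finset.sum_le_card_nsmul Finset.univ _ 2
      fun m _ ↦ (hc m).card_filter_adj_le_two hG v
  have bound := hG.four_mul_card_edgeFinset_le S (2 * k) few_neighbors
  have card_compl := S.card_add_card_compl
  obtain ⟨r, hr⟩ : ∃ r, n = 11 * k + r := ⟨n - 11 * k, by omega⟩
  have hr2 : 2 ≤ r := by omega
  have hr12 : r ≤ 12 := by omega
  rw [show (Sᶜ).card = 6 * k + r by omega, hn, hr] at bound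
  rw [hr]
  have boundR : (4 : ℝ) * G.edgeFinset.card ≤
      2 * (2 * k * (11 * k + r)) + 2 * (2 * k * (6 * k + r)) + (6 * k + r) ^ 2 := by
    exact_mod_cast bound
  push_cast
  have : (2 : ℝ) ≤ r := by exact_mod_cast hr2
  have : (r : ℝ) ≤ 12 := by exact_mod_cast hr12
  have : (0 : ℝ) ≤ k := by positivity
  nlinarith [mul_nonneg ‹(0 : ℝ) ≤ k› (sub_nonneg.2 ‹(r : ℝ) ≤ 12›)]
end

section
/- Fix two labeled vertex-disjoint 5-cycles C = x1x2x3x4x5 and D = y1y2y3y4y5. The number of 10-element sets E of cross edges (edges with one endpoint in {x1,…,x5} and the other in {y1,…,y5}) such that the graph consisting of the two cycles together with E is triangle-free is exactly 10. -/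
/-- The graph on two labeled vertex-disjoint 5-cycles `x₁…x₅` (the left summand) and
`y₁…y₅` (the right summand), together with the cross edges `xᵢyⱼ` for `(i, j) ∈ E`. -/
def twoC5WithCross (E : Finset (Fin 5 × Fin 5)) : SimpleGraph (Fin 5 ⊕ Fin 5) :=
  SimpleGraph.fromRel (fun x y =>
    (∃ i : Fin 5, x = Sum.inl i ∧ y = Sum.inl (i + 1)) ∨
    (∃ j : Fin 5, x = Sum.inr j ∧ y = Sum.inr (j + 1)) ∨
    (∃ p ∈ E, x = Sum.inl p.1 ∧ y = Sum.inr p.2))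

/-- The two cycles with cross edges `E` are triangle-free iff no two cross edges share an endpoint
and have cyclically consecutive other endpoints. -/
theorem twoC5WithCross_cliqueFree_three_iff (E : Finset (Fin 5 × Fin 5)) :
    (twoC5WithCross E).CliqueFree 3 ↔
      (∀ i j, (i, j) ∈ E → (i, j + 1) ∉ E) ∧ ∀ i j, (i, j) ∈ E → (i + 1, j) ∉ E := by
  have hll : ∀ i j, (twoC5WithCross E).Adj (Sum.inl i) (Sum.inl j) ↔ j = i + 1 ∨ i = j + 1 := by
    intro i j
    simp only [twoC5WithCross, SimpleGraph.fromRel_adj, ne_eq, Sum.inl.injEq, reduceCtorEq,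
      and_false, exists_false, or_false]
    simp only [↓existsAndEq, true_and]
    revert i j
    decide
  have hrr : ∀ i j, (twoC5WithCross E).Adj (Sum.inr i) (Sum.inr j) ↔ j = i + 1 ∨ i = j + 1 := by
    intro i j
    simp only [twoC5WithCross, SimpleGraph.fromRel_adj, ne_eq, Sum.inr.injEq, reduceCtorEq,
      false_and, and_false, exists_false, false_or, or_false]
    simp only [↓existsAndEq, true_and]
    revert i j
    decide
  have hlr : ∀ i j, (twoC5WithCross E).Adj (Sum.inl i) (Sum.inr j) ↔ (i, j) ∈ E := by
    intro i j
    simp [twoC5WithCross, SimpleGraph.fromRel_adj]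
  have hrl : ∀ i j, (twoC5WithCross E).Adj (Sum.inr j) (Sum.inl i) ↔ (i, j) ∈ E := by
    intro i j
    rw [SimpleGraph.adj_comm, hlr]
  have hcycle : ∀ a b c : Fin 5, (b = a + 1 ∨ a = b + 1) → (c = a + 1 ∨ a = c + 1) →
      ¬ (c = b + 1 ∨ b = c + 1) := by decide
  constructor
  · intro h
    refine ⟨fun i j h₁ h₂ => h {Sum.inl i, Sum.inr j, Sum.inr (j + 1)} ?_,
      fun i j h₁ h₂ => h {Sum.inr j, Sum.inl i, Sum.inl (i + 1)} ?_⟩ <;>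
    · rw [SimpleGraph.is3Clique_triple_iff]
      simp [hll, hrr, hlr, hrl, h₁, h₂]
  · rintro ⟨hrow, hcol⟩ s hs
    obtain ⟨a, b, c, hab, hac, hbc, -⟩ := SimpleGraph.is3Clique_iff.1 hs
    rcases a with a | a <;> rcases b with b | b <;> rcases c with c | c <;>
      simp only [hll, hrr, hlr, hrl] at hab hac hbc <;> grind

/-- The cross edges joining `xᵢ` to `y_{c ± i}` and `y_{c ± i + 2}`, where `q = (c, sign)`. -/
def spiralCross (q : Fin 5 × Bool) : Finset (Fin 5 × Fin 5) :=
  Finset.univ.filter fun p =>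
    p.2 = q.1 + (if q.2 then p.1 else -p.1) ∨ p.2 = q.1 + (if q.2 then p.1 else -p.1) + 2

theorem spiralCross_injective : Function.Injective spiralCross := by
  decide

theorem card_le_two_of_cyclically_independent : ∀ S : Finset (Fin 5), (∀ j ∈ S, j + 1 ∉ S) →
    S.card ≤ 2 ∧ (S.card = 2 → ∃ a, ∀ j, j ∈ S ↔ j = a ∨ j = a + 2) := by
  decide

/-- A closed walk of length five on the 5-cycle winds around it in one direction. -/
theorem closed_walk_five_eq : ∀ a b : Fin 5, (b = a + 1 ∨ b = a - 1) →
    ∀ c, (c = b + 1 ∨ c = b - 1) → ∀ d, (d = c + 1 ∨ d = c - 1) →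
    ∀ e, (e = d + 1 ∨ e = d - 1) → (a = e + 1 ∨ a = e - 1) →
    (b = a + 1 ∧ c = a + 2 ∧ d = a + 3 ∧ e = a + 4) ∨
      (b = a + -1 ∧ c = a + -2 ∧ d = a + -3 ∧ e = a + -4) := by
  rintro a _ (rfl | rfl) _ (rfl | rfl) _ (rfl | rfl) _ (rfl | rfl) <;> revert a <;> decide

theorem exists_eq_spiralCross {E : Finset (Fin 5 × Fin 5)} (hE : E.card = 10)
    (hrow : ∀ i j, (i, j) ∈ E → (i, j + 1) ∉ E) (hcol : ∀ i j, (i, j) ∈ E → (i + 1, j) ∉ E) :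
    ∃ q, spiralCross q = E := by
  let row (i : Fin 5) : Finset (Fin 5) := Finset.univ.filter fun j => (i, j) ∈ E
  have hmem : ∀ i j, j ∈ row i ↔ (i, j) ∈ E := by simp [row]
  have hsmall : ∀ i, (row i).card ≤ 2 ∧
      ((row i).card = 2 → ∃ a, ∀ j, j ∈ row i ↔ j = a ∨ j = a + 2) := fun i =>
    card_le_two_of_cyclically_independent _ fun j hj => by
      rw [hmem] at hj ⊢
      exact hrow i j hj
  have hsum : E.card = ∑ i, (row i).card := by
    rw [Finset.card_eq_sum_card_fiberwise (f := Prod.fst) (t := Finset.univ) (by simp)]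
    refine Finset.sum_congr rfl fun i _ => ?_
    refine Finset.card_bij' (fun p _ => p.2) (fun j _ => (i, j)) ?_ ?_ ?_ ?_ <;> grind
  have htwo : ∀ i, (row i).card = 2 := by
    have hle : ∀ i ∈ Finset.univ, (row i).card ≤ 2 := fun i _ => (hsmall i).1
    have := (Finset.sum_eq_sum_iff_of_le hle).1 (by rw [← hsum, hE]; simp)
    exact fun i => this i (Finset.mem_univ i)
  choose f hf using fun i => (hsmall i).2 (htwo i)
  simp only [hmem] at hf
  have hdisj : ∀ a b : Fin 5, (∀ j, (j = a ∨ j = a + 2) → ¬ (j = b ∨ j = b + 2)) →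
      b = a + 1 ∨ b = a - 1 := by decide
  have hstep : ∀ i, f (i + 1) = f i + 1 ∨ f (i + 1) = f i - 1 := fun i =>
    hdisj _ _ fun j hj => by
      rw [← hf] at hj ⊢
      exact hcol i j hj
  rcases closed_walk_five_eq _ _ (hstep 0) _ (hstep 1) _ (hstep 2) _ (hstep 3) (hstep 4) with
    ⟨h₁, h₂, h₃, h₄⟩ | ⟨h₁, h₂, h₃, h₄⟩
  · refine ⟨(f 0, true), ?_⟩
    have hfi : ∀ i, f i = f 0 + i := by
      intro i
      fin_cases i
      exacts [(add_zero _).symm, h₁, h₂, h₃, h₄]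
    ext ⟨i, j⟩
    simp [spiralCross, hf, ← hfi]
  · refine ⟨(f 0, false), ?_⟩
    have hfi : ∀ i, f i = f 0 + -i := by
      intro i
      fin_cases i
      exacts [(add_zero _).symm, h₁, h₂, h₃, h₄]
    ext ⟨i, j⟩
    simp only [spiralCross, Finset.mem_filter_univ, hf, hfi i]
    simp

theorem card_spiralCross : ∀ q, (spiralCross q).card = 10 := by
  decide

theorem spiralCross_row : ∀ q i j, (i, j) ∈ spiralCross q → (i, j + 1) ∉ spiralCross q := by
  simp only [spiralCross, Finset.mem_filter_univ]
  decide

theorem spiralCross_col : ∀ q i j, (i, j) ∈ spiralCross q → (i + 1, j) ∉ spiralCross q := by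
  simp only [spiralCross, Finset.mem_filter_univ]
  decide

/-- Fix two labeled vertex-disjoint 5-cycles. The number of 10-element sets `E` of cross
edges (each cross edge being a pair `(i, j)` representing the edge `xᵢyⱼ`) such that the two
cycles together with `E` form a triangle-free graph is exactly 10. -/
theorem card_triangleFree_ten_cross_sets :
    Nat.card {E : Finset (Fin 5 × Fin 5) //
      E.card = 10 ∧ (twoC5WithCross E).CliqueFree 3} = 10 := by
  have hset : {E : Finset (Fin 5 × Fin 5) | E.card = 10 ∧ (twoC5WithCross E).CliqueFree 3} =
      Set.range spiralCross := by
    ext E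
    simp only [Set.mem_ofPred_eq, Set.mem_range, twoC5WithCross_cliqueFree_three_iff]
    constructor
    · rintro ⟨hE, hrow, hcol⟩
      exact exists_eq_spiralCross hE hrow hcol
    · rintro ⟨q, rfl⟩
      exact ⟨card_spiralCross q, spiralCross_row q, spiralCross_col q⟩
  rw [← Set.coe_ofPred, hset, Nat.card_range_of_injective spiralCross_injective]
  simp
end

section
/- There exists a triangle-free simple graph H on 10 vertices consisting of two vertex-disjoint 5-cycles together with exactly 5 cross edges (edges with one endpoint on each cycle) such that adding any further cross edge to H creates a triangle; that is, 5 cross edges can form a maximal triangle-free set of adjacencies between two 5-cycles. -/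
instance (E : Finset (Fin 5 × Fin 5)) : DecidableRel (twoC5WithCross E).Adj :=
  fun _ _ => decidable_of_iff _ (SimpleGraph.fromRel_adj _ _ _).symm

/-- A graph is triangle-free exactly when no three vertices are pairwise adjacent. -/
lemma SimpleGraph.cliqueFree_three_iff {V : Type*} (G : SimpleGraph V) :
    G.CliqueFree 3 ↔ ∀ a b, G.Adj a b → ∀ c, G.Adj a c → ¬ G.Adj b c := by
  classical
  refine ⟨fun h a b hab c hac hbc => h {a, b, c} ?_, fun h s hs => ?_⟩
  · exact SimpleGraph.is3Clique_triple_iff.2 ⟨hab, hac, hbc⟩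
  · obtain ⟨a, b, c, hab, hac, hbc, -⟩ := SimpleGraph.is3Clique_iff.1 hs
    exact h a b hab c hac hbc

/-- There is a set of exactly 5 cross edges between two vertex-disjoint 5-cycles forming a
triangle-free graph such that adding any further cross edge creates a triangle: 5 cross edges
can form a maximal triangle-free set of adjacencies between two 5-cycles. -/
theorem exists_maximal_five_cross_edges :
    ∃ E : Finset (Fin 5 × Fin 5), E.card = 5 ∧ (twoC5WithCross E).CliqueFree 3 ∧
      ∀ p : Fin 5 × Fin 5, p ∉ E →
        ¬ (twoC5WithCross (insert p E)).CliqueFree 3 := by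
  -- The edges `(i, 2i)` form a perfect code in the torus `C₅ □ C₅`.
  refine ⟨Finset.univ.image fun i => (i, 2 * i), by decide, ?_, ?_⟩
  · rw [SimpleGraph.cliqueFree_three_iff]
    decide +kernel
  · simp only [SimpleGraph.cliqueFree_three_iff]
    decide +kernel
end

section
/- Let G be a triangle-free simple graph containing six distinct vertices u1, u2, u3, u4, v1, v2 such that u1u2, u2u3, u3u4, v1v2 are edges of G, and there is an index i ∈ {1,2,3,4} with u_i v1 an edge of G. Suppose the only edges of G incident to v1 are v1v2 and u_i v1, and the only edge of G incident to v2 is v1v2. Then there exist two non-adjacent vertices x, y among {u1, u2, u3, u4, v1, v2} such that the graph obtained from G by adding the edge xy is still triangle-free and contains a 5-cycle all of whose vertices lie in {u1, u2, u3, u4, v1, v2}. -/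
/-- Adding an edge between two vertices without a common neighbour keeps a graph
triangle-free. -/
theorem SimpleGraph.CliqueFree.sup_fromEdgeSet_of_no_common_neighbor {V : Type*}
    {G : SimpleGraph V} (hG : G.CliqueFree 3) {x y : V}
    (hxy : ∀ z, G.Adj x z → ¬ G.Adj y z) :
    (G ⊔ SimpleGraph.fromEdgeSet {s(x, y)}).CliqueFree 3 := by
  classical
  intro t ht
  obtain ⟨a, b, c, hab, hac, hbc, -⟩ := SimpleGraph.is3Clique_iff.mp ht
  have hno : ∀ a b c, G.Adj a b → G.Adj a c → ¬ G.Adj b c := fun a b c hab hac hbc =>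
    hG {a, b, c} (SimpleGraph.is3Clique_triple_iff.mpr ⟨hab, hac, hbc⟩)
  have hsymm : ∀ a b, G.Adj a b → G.Adj b a := fun _ _ h => h.symm
  simp only [SimpleGraph.sup_adj, SimpleGraph.fromEdgeSet_adj, Set.mem_singleton_iff,
    Sym2.eq_iff] at hab hac hbc
  grind

/-- If `q p a b c` is a path, `q` has `p` as its only neighbour and `p` is not adjacent to `c`,
then adding the edge `qc` keeps the graph triangle-free and closes a 5-cycle. -/
theorem SimpleGraph.exists_isC5_of_pendant_path {V : Type*} {G : SimpleGraph V}
    (hG : G.CliqueFree 3) {S : Set V} {q p a b c : V}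
    (hS : q ∈ S ∧ p ∈ S ∧ a ∈ S ∧ b ∈ S ∧ c ∈ S)
    (hdist : List.Nodup [q, p, a, b, c])
    (hpq : G.Adj p q) (hap : G.Adj a p) (hab : G.Adj a b) (hbc : G.Adj b c)
    (hq : ∀ x, G.Adj q x → x = p) (hpc : ¬ G.Adj p c) :
    ∃ x ∈ S, ∃ y ∈ S, x ≠ y ∧ ¬ G.Adj x y ∧
      (G ⊔ SimpleGraph.fromEdgeSet {s(x, y)}).CliqueFree 3 ∧
      ∃ f : Fin 5 → V, (G ⊔ SimpleGraph.fromEdgeSet {s(x, y)}).IsC5 f ∧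
        ∀ i : Fin 5, f i ∈ S := by
  obtain ⟨hqS, hpS, haS, hbS, hcS⟩ := hS
  have hqc : q ≠ c := by grind
  refine ⟨q, hqS, c, hcS, hqc, fun h => by grind, ?_, ![q, p, a, b, c], ⟨?_, ?_⟩, ?_⟩
  · refine hG.sup_fromEdgeSet_of_no_common_neighbor fun z hz hcz => hpc ?_
    exact hq z hz ▸ hcz.symm
  · exact List.nodup_ofFn.mp (by simpa [List.ofFn_succ] using hdist)
  · intro i
    fin_cases i
    · exact Or.inl hpq.symm
    · exact Or.inl hap.symm
    · exact Or.inl hab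
    · exact Or.inl hbc
    · exact Or.inr ((SimpleGraph.fromEdgeSet_adj _).mpr ⟨Sym2.eq_swap, hqc.symm⟩)
  · intro i
    fin_cases i <;> assumption

/-- A path `u₁u₂u₃u₄` has been joined by an edge `uᵢv₁` to a path `v₁v₂` whose two vertices
are otherwise untouched.  Then some edge between two non-adjacent vertices of the
configuration can be added so that the graph stays triangle-free and acquires a 5-cycle
inside the configuration. -/
theorem complete_C5_from_P4_P2 {V : Type*} {G : SimpleGraph V} (hG : G.CliqueFree 3)
    (u1 u2 u3 u4 v1 v2 : V)
    (hdist : List.Pairwise (· ≠ ·) [u1, u2, u3, u4, v1, v2])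
    (h12 : G.Adj u1 u2) (h23 : G.Adj u2 u3) (h34 : G.Adj u3 u4) (hv : G.Adj v1 v2)
    (hjoin : ∃ w ∈ ({u1, u2, u3, u4} : Set V), G.Adj w v1 ∧
      ∀ x : V, G.Adj v1 x → x = v2 ∨ x = w)
    (hv2only : ∀ x : V, G.Adj v2 x → x = v1) :
    ∃ x ∈ ({u1, u2, u3, u4, v1, v2} : Set V), ∃ y ∈ ({u1, u2, u3, u4, v1, v2} : Set V),
      x ≠ y ∧ ¬ G.Adj x y ∧
      (G ⊔ SimpleGraph.fromEdgeSet {s(x, y)}).CliqueFree 3 ∧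
      ∃ c : Fin 5 → V, (G ⊔ SimpleGraph.fromEdgeSet {s(x, y)}).IsC5 c ∧
        ∀ i : Fin 5, c i ∈ ({u1, u2, u3, u4, v1, v2} : Set V) := by
  obtain ⟨w, hw, hwv, hv1⟩ := hjoin
  simp only [Set.mem_insert_iff, Set.mem_singleton_iff] at hw
  rcases hw with rfl | rfl | rfl | rfl
  · exact SimpleGraph.exists_isC5_of_pendant_path hG (by simp) (by grind) hv hwv h12 h23
      hv2only (by grind)
  · exact SimpleGraph.exists_isC5_of_pendant_path hG (by simp) (by grind) hv hwv h23 h34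
      hv2only (by grind)
  · exact SimpleGraph.exists_isC5_of_pendant_path hG (by simp) (by grind) hv hwv h23.symm
      h12.symm hv2only (by grind)
  · exact SimpleGraph.exists_isC5_of_pendant_path hG (by simp) (by grind) hv hwv h34.symm
      h23.symm hv2only (by grind)
end

section
/- Let G be a triangle-free simple graph containing seven distinct vertices u1, u2, u3, u4, v1, v2, v3 such that u1u2, u2u3, u3u4, v1v2, v2v3 are edges of G, and there is exactly one edge of G joining {u1,u2,u3,u4} to {v1,v2,v3}. Suppose the only edges of G incident to any of v1, v2, v3 are the path edges v1v2, v2v3 and that single joining edge. Then there exist two non-adjacent vertices x, y among {u1, u2, u3, u4, v1, v2, v3} such that the graph obtained from G by adding the edge xy is still triangle-free and contains a 5-cycle all of whose vertices lie in {u1, u2, u3, u4, v1, v2, v3}. -/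
namespace SimpleGraph

variable {V : Type*} {G : SimpleGraph V}

/-- Joining two vertices without a common neighbour creates no triangle. -/
theorem CliqueFree.sup_fromEdgeSet_of_no_common_neighbor_s11 (hG : G.CliqueFree 3) {x y : V}
    (h : ∀ z, G.Adj x z → ¬ G.Adj z y) :
    (G ⊔ fromEdgeSet {s(x, y)}).CliqueFree 3 := by
  classical
  intro s hs
  obtain ⟨a, b, c, hab, hac, hbc, rfl⟩ := is3Clique_iff.mp hs
  have hfree : ∀ a b c, G.Adj a b → G.Adj a c → ¬ G.Adj b c := fun a b c hab hac hbc =>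
    hG {a, b, c} (is3Clique_triple_iff.mpr ⟨hab, hac, hbc⟩)
  have hsymm : ∀ a b, G.Adj a b → G.Adj b a := fun _ _ hab => hab.symm
  simp only [sup_adj, fromEdgeSet_adj, Set.mem_singleton_iff, Sym2.eq_iff] at hab hac hbc
  grind

/-- Closing a path on five vertices whose first vertex is a leaf, and whose second and last
vertices are not adjacent, creates a 5-cycle and no triangle. -/
theorem CliqueFree.exists_isC5_of_leaf_path (hG : G.CliqueFree 3) {S : Set V}
    {p q r s t : V} (hdist : List.Pairwise (· ≠ ·) [p, q, r, s, t])
    (hmem : ∀ z ∈ [p, q, r, s, t], z ∈ S)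
    (hpq : G.Adj p q) (hqr : G.Adj q r) (hrs : G.Adj r s) (hst : G.Adj s t)
    (hleaf : ∀ z, G.Adj p z → z = q) (hqt : ¬ G.Adj q t) :
    ∃ x ∈ S, ∃ y ∈ S, x ≠ y ∧ ¬ G.Adj x y ∧
      (G ⊔ fromEdgeSet {s(x, y)}).CliqueFree 3 ∧
      ∃ c : Fin 5 → V, (G ⊔ fromEdgeSet {s(x, y)}).IsC5 c ∧ ∀ i : Fin 5, c i ∈ S := by
  have hpt : p ≠ t := by grind
  refine ⟨p, hmem p (by simp), t, hmem t (by simp), hpt, fun h => ?_,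
    hG.sup_fromEdgeSet_of_no_common_neighbor_s11 fun z hz => hleaf z hz ▸ hqt,
    ![p, q, r, s, t], ⟨?_, ?_⟩, ?_⟩
  · have := hleaf t h
    grind
  · rw [← List.nodup_ofFn]
    simpa [List.Nodup] using hdist
  · intro i
    fin_cases i
    · exact Or.inl hpq
    · exact Or.inl hqr
    · exact Or.inl hrs
    · exact Or.inl hst
    · exact Or.inr (by simp [Sym2.eq_swap, hpt.symm])
  · intro i
    fin_cases i <;> exact hmem _ (by simp)

end SimpleGraph

/-- A path `u₁u₂u₃u₄` is joined by exactly one edge to a path `v₁v₂v₃` whose three vertices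
are otherwise untouched.  Then some edge between two non-adjacent vertices of the
configuration can be added so that the graph stays triangle-free and acquires a 5-cycle
inside the configuration. -/
theorem complete_C5_from_P4_P3 {V : Type*} {G : SimpleGraph V} (hG : G.CliqueFree 3)
    (u1 u2 u3 u4 v1 v2 v3 : V)
    (hdist : List.Pairwise (· ≠ ·) [u1, u2, u3, u4, v1, v2, v3])
    (h12 : G.Adj u1 u2) (h23 : G.Adj u2 u3) (h34 : G.Adj u3 u4)
    (hv12 : G.Adj v1 v2) (hv23 : G.Adj v2 v3)
    (hjoin : ∃ a ∈ ({u1, u2, u3, u4} : Set V), ∃ b ∈ ({v1, v2, v3} : Set V),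
      G.Adj a b ∧
      (∀ a' ∈ ({u1, u2, u3, u4} : Set V), ∀ b' ∈ ({v1, v2, v3} : Set V),
        G.Adj a' b' → a' = a ∧ b' = b) ∧
      (∀ y ∈ ({v1, v2, v3} : Set V), ∀ x : V, G.Adj y x →
        (y = v1 ∧ x = v2) ∨ (y = v2 ∧ x = v1) ∨ (y = v2 ∧ x = v3) ∨ (y = v3 ∧ x = v2) ∨
        (y = b ∧ x = a))) :
    ∃ x ∈ ({u1, u2, u3, u4, v1, v2, v3} : Set V),
      ∃ y ∈ ({u1, u2, u3, u4, v1, v2, v3} : Set V),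
      x ≠ y ∧ ¬ G.Adj x y ∧
      (G ⊔ SimpleGraph.fromEdgeSet {s(x, y)}).CliqueFree 3 ∧
      ∃ c : Fin 5 → V, (G ⊔ SimpleGraph.fromEdgeSet {s(x, y)}).IsC5 c ∧
        ∀ i : Fin 5, c i ∈ ({u1, u2, u3, u4, v1, v2, v3} : Set V) := by
  obtain ⟨a, ha, b, hb, hab, huniq, hnbr⟩ := hjoin
  obtain ⟨w, hw, z, hz, haw, hwz, haz⟩ : ∃ w ∈ ({u1, u2, u3, u4} : Set V),
      ∃ z ∈ ({u1, u2, u3, u4} : Set V), G.Adj a w ∧ G.Adj w z ∧ a ≠ z := by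
    rcases ha with rfl | rfl | rfl | rfl
    · exact ⟨u2, by simp, u3, by simp, h12, h23, by grind⟩
    · exact ⟨u3, by simp, u4, by simp, h23, h34, by grind⟩
    · exact ⟨u2, by simp, u1, by simp, h23.symm, h12.symm, by grind⟩
    · exact ⟨u3, by simp, u2, by simp, h34.symm, h23.symm, by grind⟩
  have haw' := haw.ne
  have hwz' := hwz.ne
  simp only [Set.mem_insert_iff, Set.mem_singleton_iff] at ha hb hw hz huniq hnbr
  rcases hb with rfl | rfl | rfl
  · exact hG.exists_isC5_of_leaf_path (p := v3) (q := v2) (r := b) (s := a) (t := w)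
      (by grind) (by grind) hv23.symm hv12.symm hab.symm haw (by grind) (by grind)
  · exact hG.exists_isC5_of_leaf_path (p := v1) (q := b) (r := a) (s := w) (t := z)
      (by grind) (by grind) hv12 hab.symm haw hwz (by grind) (by grind)
  · exact hG.exists_isC5_of_leaf_path (p := v1) (q := v2) (r := b) (s := a) (t := w)
      (by grind) (by grind) hv12 hv23 hab.symm haw (by grind) (by grind)
end

section
/- Let m ∈ {2, 3, 4} and let G be a triangle-free simple graph containing distinct vertices u1, u2, u3, u4 forming a 4-cycle (edges u1u2, u2u3, u3u4, u4u1) and distinct vertices v1, …, vm disjoint from the u's forming a path (edges v1v2, …, v_{m−1}v_m), such that there is exactly one edge of G joining {u1,u2,u3,u4} to {v1,…,vm}, and the only edges of G incident to any of v1, …, vm are the path edges and that single joining edge. Then there exist two non-adjacent vertices x, y among {u1, u2, u3, u4, v1, …, vm} such that the graph obtained from G by adding the edge xy is still triangle-free and contains a 5-cycle all of whose vertices lie in {u1, u2, u3, u4, v1, …, vm}. -/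
/-- Joining two vertices without a common neighbour keeps a graph triangle-free. -/
lemma SimpleGraph.CliqueFree.three_sup_fromEdgeSet_singleton {V : Type*} {G : SimpleGraph V}
    (hG : G.CliqueFree 3) {x y : V} (hxy : ∀ w, G.Adj x w → ¬ G.Adj y w) :
    (G ⊔ SimpleGraph.fromEdgeSet {s(x, y)}).CliqueFree 3 := by
  classical
  have hG' : ∀ a b c, G.Adj a b → G.Adj a c → ¬ G.Adj b c := fun a b c hab hac hbc =>
    hG {a, b, c} (SimpleGraph.is3Clique_triple_iff.2 ⟨hab, hac, hbc⟩)
  intro s hs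
  obtain ⟨a, b, c, hab, hac, hbc, -⟩ := SimpleGraph.is3Clique_iff.1 hs
  simp only [SimpleGraph.sup_adj, SimpleGraph.fromEdgeSet_adj, Set.mem_singleton_iff,
    Sym2.eq_iff] at hab hac hbc
  grind [SimpleGraph.adj_comm]

/-- Closing a path `c b a p q` by the edge `cq` yields a 5-cycle. -/
lemma SimpleGraph.isC5_sup_fromEdgeSet_of_path {V : Type*} {G : SimpleGraph V} {a b c p q : V}
    (hnodup : [c, b, a, p, q].Nodup) (hcb : G.Adj c b) (hba : G.Adj b a) (hap : G.Adj a p)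
    (hpq : G.Adj p q) :
    (G ⊔ SimpleGraph.fromEdgeSet {s(c, q)}).IsC5 ![c, b, a, p, q] := by
  constructor
  · exact List.nodup_ofFn.1 (by simpa [List.ofFn_succ] using hnodup)
  · have hqc : q ≠ c := by grind
    intro i
    fin_cases i <;> simp [hcb, hba, hap, hpq, hqc]

/-- A 4-cycle `u₁u₂u₃u₄` is joined by exactly one edge to a disjoint path `v₁…v_m`
(`m ∈ {2,3,4}`) whose vertices are otherwise untouched.  Then some edge between two
non-adjacent vertices of the configuration can be added so that the graph stays
triangle-free and acquires a 5-cycle inside the configuration. -/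
theorem complete_C5_from_C4_path {V : Type*} {G : SimpleGraph V} (hG : G.CliqueFree 3)
    {m : ℕ} (hm : m = 2 ∨ m = 3 ∨ m = 4)
    (u1 u2 u3 u4 : V) (v : Fin m → V)
    (hu : List.Pairwise (· ≠ ·) [u1, u2, u3, u4])
    (hvinj : Function.Injective v)
    (hvu : ∀ i : Fin m, v i ∉ ({u1, u2, u3, u4} : Set V))
    (h12 : G.Adj u1 u2) (h23 : G.Adj u2 u3) (h34 : G.Adj u3 u4) (h41 : G.Adj u4 u1)
    (hpath : ∀ i j : Fin m, (i : ℕ) + 1 = (j : ℕ) → G.Adj (v i) (v j))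
    (hjoin : ∃ a ∈ ({u1, u2, u3, u4} : Set V), ∃ b : Fin m,
      G.Adj a (v b) ∧
      (∀ a' ∈ ({u1, u2, u3, u4} : Set V), ∀ b' : Fin m,
        G.Adj a' (v b') → a' = a ∧ b' = b) ∧
      (∀ j : Fin m, ∀ x : V, G.Adj (v j) x →
        (∃ i : Fin m, ((i : ℕ) + 1 = (j : ℕ) ∨ (j : ℕ) + 1 = (i : ℕ)) ∧ x = v i) ∨
        (j = b ∧ x = a))) :
    ∃ x ∈ ({u1, u2, u3, u4} : Set V) ∪ Set.range v,
      ∃ y ∈ ({u1, u2, u3, u4} : Set V) ∪ Set.range v,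
      x ≠ y ∧ ¬ G.Adj x y ∧
      (G ⊔ SimpleGraph.fromEdgeSet {s(x, y)}).CliqueFree 3 ∧
      ∃ c : Fin 5 → V, (G ⊔ SimpleGraph.fromEdgeSet {s(x, y)}).IsC5 c ∧
        ∀ i : Fin 5, c i ∈ ({u1, u2, u3, u4} : Set V) ∪ Set.range v := by
  obtain ⟨a, ha, b, hab, huniq, hnbr⟩ := hjoin
  have exists_path : ∃ p ∈ ({u1, u2, u3, u4} : Set V), ∃ q ∈ ({u1, u2, u3, u4} : Set V),
      q ≠ a ∧ G.Adj a p ∧ G.Adj p q := by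
    simp only [Set.mem_insert_iff, Set.mem_singleton_iff] at ha
    rcases ha with rfl | rfl | rfl | rfl
    · exact ⟨u2, by simp, u3, by simp, by grind, h12, h23⟩
    · exact ⟨u3, by simp, u4, by simp, by grind, h23, h34⟩
    · exact ⟨u4, by simp, u1, by simp, by grind, h34, h41⟩
    · exact ⟨u1, by simp, u2, by simp, by grind, h41, h12⟩
  have exists_neighbor : ∃ c, G.Adj (v c) (v b) := by
    by_cases hb : (b : ℕ) = 0
    · exact ⟨⟨1, by omega⟩, (hpath _ _ (by simp [hb])).symm⟩
    · exact ⟨⟨b - 1, by omega⟩, hpath _ _ (by simp; omega)⟩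
  obtain ⟨p, hp, q, hq, hqa, hap, hpq⟩ := exists_path
  obtain ⟨c, hcb⟩ := exists_neighbor
  have hqv (i : Fin m) : ¬ G.Adj q (v i) := fun h => hqa (huniq q hq i h).1
  have ne_v {x : V} (hx : x ∈ ({u1, u2, u3, u4} : Set V)) (i : Fin m) : v i ≠ x :=
    fun h => hvu i (h ▸ hx)
  have hnodup : [v c, v b, a, p, q].Nodup := by
    simp [hcb.ne, ne_v ha, ne_v hp, ne_v hq, hap.ne, hpq.ne, hqa.symm]
  refine ⟨v c, Or.inr ⟨c, rfl⟩, q, Or.inl hq, ne_v hq c, fun h => hqv c h.symm,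
    hG.three_sup_fromEdgeSet_singleton fun w hcw hqw => ?_, ![v c, v b, a, p, q],
    SimpleGraph.isC5_sup_fromEdgeSet_of_path hnodup hcb hab.symm hap hpq, fun i => ?_⟩
  · obtain ⟨i, -, rfl⟩ | ⟨rfl, -⟩ := hnbr c w hcw
    · exact hqv i hqw
    · exact hcb.ne rfl
  · fin_cases i
    exacts [Or.inr ⟨c, rfl⟩, Or.inr ⟨b, rfl⟩, Or.inl ha, Or.inl hp, Or.inl hq]
end
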